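/- There exists a smooth divergence-free vector field u(t,x) = (u₁(t,x), u₂(t,x)) on ℝ² (space-time over ℝ¹) such that u₁(t,·) ≥ 0 is compactly supported for each t, ∫_ℝ u₁(t,x) dx is not constant in t, and consequently u cannot be written in the form u = (ρ, ρv) for any smooth v. -/

import Mathlib

theorem Continuous.hasDerivAt_primitive {f : ℝ → ℝ} (hf : Continuous f) (a x : ℝ) :
    HasDerivAt (fun x => ∫ y in a..x, f y) (f x) x :=
  intervalIntegral.integral_hasDerivAt_right (hf.intervalIntegrable _ _)
    (hf.stronglyMeasurableAtFilter _ _) hf.continuousAt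

theorem ContDiff.primitive {f : ℝ → ℝ} (hf : ContDiff ℝ (⊤ : ℕ∞) f) (a : ℝ) :
    ContDiff ℝ (⊤ : ℕ∞) (fun x => ∫ y in a..x, f y) := by
  have hd := hf.continuous.hasDerivAt_primitive a
  rw [contDiff_infty_iff_deriv]
  refine ⟨fun x => (hd x).differentiableAt, ?_⟩
  rwa [show deriv (fun x => ∫ y in a..x, f y) = f from funext fun x => (hd x).deriv]

/-- There is a smooth divergence-free space-time vector field `u = (u₁, u₂)` on
`ℝ² = ℝ_t × ℝ_x` such that `u₁(t,·) ≥ 0` is compactly supported for each `t`, the total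
mass `∫ u₁(t,x) dx` is not constant in `t`, and consequently `u` cannot be written in
the form `(ρ, ρ v)` (with `ρ = u₁`) for any `v`. -/
theorem stmt_14 :
    ∃ u₁ u₂ : ℝ → ℝ → ℝ,
      ContDiff ℝ (⊤ : ℕ∞) (fun p : ℝ × ℝ => u₁ p.1 p.2) ∧
      ContDiff ℝ (⊤ : ℕ∞) (fun p : ℝ × ℝ => u₂ p.1 p.2) ∧
      (∀ t x : ℝ, deriv (fun s => u₁ s x) t + deriv (fun y => u₂ t y) x = 0) ∧
      (∀ t x : ℝ, 0 ≤ u₁ t x) ∧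
      (∀ t : ℝ, HasCompactSupport (fun x => u₁ t x)) ∧
      ¬(∀ s t : ℝ, (∫ x : ℝ, u₁ s x) = ∫ x : ℝ, u₁ t x) ∧
      ¬∃ v : ℝ → ℝ → ℝ, ∀ t x : ℝ, u₂ t x = u₁ t x * v t x := by
  let φ : ContDiffBump (0 : ℝ) := ⟨1, 2, one_pos, one_lt_two⟩
  have hφ : ContDiff ℝ (⊤ : ℕ∞) (φ : ℝ → ℝ) := φ.contDiff
  refine ⟨fun t x => Real.exp t * φ x, fun t x => -(Real.exp t * ∫ y in (0 : ℝ)..x, φ y),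
    ?_, ?_, fun t x => ?_, fun t x => ?_, fun t => ?_, fun h => ?_, ?_⟩
  · exact (Real.contDiff_exp.comp contDiff_fst).mul (hφ.comp contDiff_snd)
  · exact ((Real.contDiff_exp.comp contDiff_fst).mul
      ((hφ.primitive 0).comp contDiff_snd)).neg
  · have hΦ := hφ.continuous.hasDerivAt_primitive 0 x
    rw [((Real.hasDerivAt_exp t).mul_const (φ x)).deriv,
      (hΦ.const_mul (Real.exp t)).fun_neg.deriv]
    ring
  · exact mul_nonneg (Real.exp_pos t).le φ.nonneg
  · exact φ.hasCompactSupport.mul_left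
  · have hpos : 0 < ∫ x, φ x := φ.integral_pos
    have h01 := h 0 1
    simp only [MeasureTheory.integral_const_mul] at h01
    have hlt : Real.exp 0 < Real.exp 1 := Real.exp_lt_exp.2 one_pos
    exact (mul_lt_mul_of_pos_right hlt hpos).ne h01
  · rintro ⟨v, hv⟩
    have hzero : φ 2 = 0 := φ.zero_of_le_dist (by simp [φ])
    have hpos : 0 < ∫ y in (0 : ℝ)..2, φ y := by
      refine intervalIntegral.intervalIntegral_pos_of_pos_on
        (hφ.continuous.intervalIntegrable _ _) (fun x hx => φ.pos_of_mem_ball ?_) two_pos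
      rw [mem_ball_zero_iff, Real.norm_of_nonneg hx.1.le]
      exact hx.2
    have h2 := hv 0 2
    simp only [hzero, Real.exp_zero, one_mul, zero_mul] at h2
    linarith
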